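/- Fix an integer n ≥ 2, x₀ > 0, and κ > 0 with κ ≠ 1 (κ = 1 - 2μ/σ² for exponential Brownian motion with drift μ and volatility σ, 2μ < σ²). Let λ(·) = (1 - n·(·) + (n-1)·(·)^{n/(n-1)})/n, and for c ∈ [0,1) let H_c be the equilibrium cdf H_c(x) = (c + λ(c)·(x/x₀)^κ)^{1/(n-1)} on [0, x̄(c)], x̄(c) = ((1-c)/λ(c))^{1/κ}·x₀, H_c = 1 above x̄(c). Define the mean m(c) = ∫₀^∞ (1 - H_c(x)) dx. Then for any 0 ≤ ĉ < c < 1: if 0 < κ < 1 (i.e., μ > 0) then m(ĉ) < m(c), and if κ > 1 (i.e., μ < 0) then m(ĉ) > m(c). -/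

import Mathlib

open MeasureTheory

/-- The slope coefficient `λ(c) = (1 - n·c + (n-1)·c^{n/(n-1)})/n` of the equilibrium
winning probability in the `n`-player risk-taking contest with submission fee `c`. -/
noncomputable def lamFee (n : ℕ) (c : ℝ) : ℝ :=
  (1 - n * c + ((n : ℝ) - 1) * c ^ ((n : ℝ) / ((n : ℝ) - 1))) / n

/-- Upper bound of the support of the equilibrium distribution for exponential Brownian
motion (scale function `s(x) = x^κ/κ`): `x̄(c) = ((1-c)/λ(c))^{1/κ}·x₀`. -/
noncomputable def expXbar (n : ℕ) (x₀ κ c : ℝ) : ℝ :=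
  ((1 - c) / lamFee n c) ^ (1 / κ) * x₀

/-- Equilibrium cdf for exponential Brownian motion:
`H_c(x) = (c + λ(c)·(x/x₀)^κ)^{1/(n-1)}` on `[0, x̄(c)]`, `1` above, `0` below `0`. -/
noncomputable def expF (n : ℕ) (x₀ κ c x : ℝ) : ℝ :=
  if x < 0 then 0
  else if x ≤ expXbar n x₀ κ c then
    (c + lamFee n c * (x / x₀) ^ κ) ^ ((1 : ℝ) / ((n : ℝ) - 1))
  else 1

/-- Mean of the equilibrium distribution: `m(c) = ∫₀^∞ (1 - H_c(x)) dx`. -/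
noncomputable def expMean (n : ℕ) (x₀ κ c : ℝ) : ℝ :=
  ∫ x in Set.Ioi (0 : ℝ), (1 - expF n x₀ κ c x)

open Set

/-- The survival function `1 - min(1, c + l·y)^p`. -/
noncomputable def cappedSurvival (p c l y : ℝ) : ℝ := 1 - (min 1 (c + l * y)) ^ p

lemma continuous_cappedSurvival {p : ℝ} (hp : 0 ≤ p) (c l : ℝ) :
    Continuous (cappedSurvival p c l) := by
  unfold cappedSurvival
  exact continuous_const.sub
    ((continuous_const.min (by fun_prop)).rpow_const fun _ => Or.inr hp)

lemma cappedSurvival_eq_zero {p c l y : ℝ} (h : 1 ≤ c + l * y) : cappedSurvival p c l y = 0 := by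
  simp [cappedSurvival, min_eq_left h]

lemma cappedSurvival_le {p c l c' l' y : ℝ} (hp : 0 ≤ p) (h0 : 0 ≤ c' + l' * y)
    (h : c' + l' * y ≤ c + l * y) : cappedSurvival p c l y ≤ cappedSurvival p c' l' y := by
  unfold cappedSurvival
  gcongr

lemma cappedSurvival_lt {p c l c' l' y : ℝ} (hp : 0 < p) (h0 : 0 ≤ c' + l' * y)
    (h : c' + l' * y < c + l * y) (h1 : c' + l' * y < 1) :
    cappedSurvival p c l y < cappedSurvival p c' l' y := by
  unfold cappedSurvival
  rw [min_eq_right h1.le]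
  have := Real.rpow_lt_rpow h0 (lt_min h1 h) hp
  linarith

lemma integrableOn_Ioi_of_continuous_of_eq_zero {f : ℝ → ℝ} (hf : Continuous f) {R : ℝ}
    (h : ∀ x, R ≤ x → f x = 0) (a : ℝ) : IntegrableOn f (Ioi a) :=
  (hf.integrableOn_Icc (a := a) (b := R)).of_forall_sdiff_eq_zero measurableSet_Ioi fun x hx =>
    h x (le_of_not_ge fun hxR => hx.2 ⟨le_of_lt hx.1, hxR⟩)

lemma cappedSurvival_eq_zero_of_le {p c l y : ℝ} (hl : 0 < l) (h : (1 - c) / l ≤ y) :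
    cappedSurvival p c l y = 0 := by
  rw [div_le_iff₀ hl] at h
  exact cappedSurvival_eq_zero (by linarith)

lemma integral_cappedSurvival {p c l : ℝ} (hp : 0 < p) (hl : 0 < l) (hc1 : c < 1) :
    ∫ y in Ioi (0 : ℝ), cappedSurvival p c l y
      = (1 - c - (1 - c ^ (p + 1)) / (p + 1)) / l := by
  have hY : 0 ≤ (1 - c) / l := div_nonneg (by linarith) hl.le
  have h1 : ∫ y in Ioi (0 : ℝ), cappedSurvival p c l y
      = ∫ y in (0 : ℝ)..(1 - c) / l, (1 - (c + l * y) ^ p) := by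
    rw [intervalIntegral.integral_of_le hY,
      setIntegral_eq_of_subset_of_forall_sdiff_eq_zero measurableSet_Ioi
        (Ioc_subset_Ioi_self : Ioc 0 ((1 - c) / l) ⊆ Ioi 0)
        fun x hx => cappedSurvival_eq_zero_of_le hl
          (le_of_not_ge fun hxR => hx.2 ⟨hx.1, hxR⟩)]
    refine setIntegral_congr_fun measurableSet_Ioc fun y hy => ?_
    have : y * l ≤ 1 - c := (le_div_iff₀ hl).1 hy.2
    simp only [cappedSurvival]
    rw [min_eq_right (by linarith)]
  rw [h1, intervalIntegral.integral_comp_add_mul (fun u : ℝ => 1 - u ^ p) hl.ne',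
    show c + l * ((1 - c) / l) = 1 by field_simp; ring, mul_zero, add_zero,
    intervalIntegral.integral_sub (by simp)
      (intervalIntegral.intervalIntegrable_rpow (Or.inl hp.le)),
    integral_rpow (Or.inl (by linarith))]
  simp only [intervalIntegral.integral_const, Real.one_rpow, smul_eq_mul, mul_one]
  field_simp

lemma integrableOn_cappedSurvival_rpow {p c l κ : ℝ} (hp : 0 ≤ p) (hl : 0 < l) (hc1 : c < 1)
    (hκ : 0 < κ) : IntegrableOn (fun x => cappedSurvival p c l (x ^ κ)) (Ioi 0) := by
  have hY : 0 ≤ (1 - c) / l := div_nonneg (by linarith) hl.le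
  refine integrableOn_Ioi_of_continuous_of_eq_zero (R := ((1 - c) / l) ^ κ⁻¹)
    ((continuous_cappedSurvival hp c l).comp (Real.continuous_rpow_const hκ.le)) (fun x hx => ?_) 0
  have hx0 : 0 ≤ x := (Real.rpow_nonneg hY _).trans hx
  exact cappedSurvival_eq_zero_of_le hl ((Real.rpow_inv_le_iff_of_pos hY hx0 hκ).1 hx)

lemma integrableOn_rpow_mul_cappedSurvival {p c l κ : ℝ} (hp : 0 ≤ p) (hl : 0 < l) (hκ : 0 < κ) :
    IntegrableOn (fun x => x ^ (κ - 1) * cappedSurvival p c l (x ^ κ)) (Ioi 0) :=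
  (integrableOn_Ioi_comp_rpow_iff' (cappedSurvival p c l) hκ.ne').2
    (integrableOn_Ioi_of_continuous_of_eq_zero (continuous_cappedSurvival hp c l)
      (fun _ => cappedSurvival_eq_zero_of_le hl) 0)

lemma integral_rpow_mul_cappedSurvival {p c l κ : ℝ} (hκ : 0 < κ) :
    ∫ x in Ioi (0 : ℝ), x ^ (κ - 1) * cappedSurvival p c l (x ^ κ)
      = (∫ y in Ioi (0 : ℝ), cappedSurvival p c l y) / κ := by
  rw [← integral_comp_rpow_Ioi_of_pos (g := cappedSurvival p c l) hκ, eq_div_iff hκ.ne',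
    mul_comm, ← integral_const_mul]
  simp only [smul_eq_mul, mul_assoc]

/-- Two functions with the same `w`-weighted integral, whose difference changes sign where the
weight `w` crosses the level `k`, have ordered integrals. -/
lemma setIntegral_lt_of_single_crossing {f g w : ℝ → ℝ} {k δ : ℝ} (hk : 0 < k) (hδ : 0 < δ)
    (hf : IntegrableOn f (Ioi 0)) (hg : IntegrableOn g (Ioi 0))
    (hwf : IntegrableOn (fun x => w x * f x) (Ioi 0))
    (hwg : IntegrableOn (fun x => w x * g x) (Ioi 0))
    (heq : ∫ x in Ioi (0 : ℝ), w x * f x = ∫ x in Ioi (0 : ℝ), w x * g x)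
    (hnonneg : ∀ x, 0 < x → 0 ≤ (f x - g x) * (k - w x))
    (hpos : ∀ x, 0 < x → x < δ → 0 < (f x - g x) * (k - w x)) :
    ∫ x in Ioi (0 : ℝ), g x < ∫ x in Ioi (0 : ℝ), f x := by
  have hfun : (fun x => (f x - g x) * (k - w x))
      = fun x => k * (f x - g x) - (w x * f x - w x * g x) := by
    ext x; ring
  have hfg : IntegrableOn (fun x => k * (f x - g x)) (Ioi 0) := (hf.sub hg).const_mul k
  have hwfg : IntegrableOn (fun x => w x * f x - w x * g x) (Ioi 0) := hwf.sub hwg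
  have hint : IntegrableOn (fun x => (f x - g x) * (k - w x)) (Ioi 0) := by
    rw [hfun]
    exact hfg.sub hwfg
  have hlt : 0 < ∫ x in Ioi (0 : ℝ), (f x - g x) * (k - w x) := by
    rw [setIntegral_pos_iff_support_of_nonneg_ae
      ((ae_restrict_iff' measurableSet_Ioi).2 (Filter.Eventually.of_forall hnonneg)) hint]
    refine lt_of_lt_of_le ?_ (measure_mono (μ := volume) (s := Ioo 0 δ)
      fun x hx => ⟨(hpos x hx.1 hx.2).ne', hx.1⟩)
    simpa using hδ
  rw [hfun, integral_sub hfg hwfg, integral_sub hwf hwg, heq, sub_self, sub_zero,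
    integral_const_mul, integral_sub hf hg] at hlt
  exact sub_pos.1 ((mul_pos_iff_of_pos_left hk).1 hlt)

lemma rpow_tangent_lt {q a b : ℝ} (hq : 1 < q) (ha : 0 ≤ a) (hab : a < b) (hb : b ≤ 1) :
    b ^ q - a ^ q < q * (b - a) := by
  have hb0 : 0 < b := ha.trans_lt hab
  have h := one_add_mul_self_lt_rpow_one_add (s := a / b - 1)
    (by linarith [div_nonneg ha hb0.le])
    (by rw [sub_ne_zero, Ne, div_eq_one_iff_eq hb0.ne']; exact hab.ne) hq
  rw [add_sub_cancel, Real.div_rpow ha hb0.le, lt_div_iff₀ (Real.rpow_pos_of_pos hb0 q)] at h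
  have hbq : b ^ q ≤ b := by
    simpa using Real.rpow_le_rpow_of_exponent_ge hb0 hb hq.le
  have hd : 0 ≤ q * (1 - a / b) :=
    mul_nonneg (by linarith) (by rw [sub_nonneg, div_le_one hb0]; exact hab.le)
  have h2 := mul_le_mul_of_nonneg_left hbq hd
  have h3 : q * (1 - a / b) * b = q * (b - a) := by field_simp
  nlinarith

lemma lamFee_eq {n : ℕ} (hn : 2 ≤ n) (c : ℝ) :
    lamFee n c = (1 - c) - (1 - c ^ (1 / ((n : ℝ) - 1) + 1)) / (1 / ((n : ℝ) - 1) + 1) := by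
  have hn' : (2 : ℝ) ≤ n := by exact_mod_cast hn
  have h1 : (n : ℝ) - 1 ≠ 0 := by linarith
  have h2 : 1 / ((n : ℝ) - 1) + 1 = n / (n - 1) := by field_simp; ring
  rw [h2, lamFee]
  field_simp
  ring

lemma lamFee_strictAntiOn {n : ℕ} (hn : 2 ≤ n) : StrictAntiOn (lamFee n) (Icc 0 1) := by
  intro a ha b hb hab
  have hn' : (2 : ℝ) ≤ n := by exact_mod_cast hn
  rw [lamFee_eq hn, lamFee_eq hn]
  set q := 1 / ((n : ℝ) - 1) + 1
  have hq : 1 < q := by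
    have : 0 < 1 / ((n : ℝ) - 1) := one_div_pos.2 (by linarith)
    linarith
  have h := rpow_tangent_lt hq ha.1 hab hb.2
  rw [← div_lt_iff₀' (by linarith), sub_div] at h
  rw [sub_div, sub_div]
  linarith

lemma lamFee_pos {n : ℕ} (hn : 2 ≤ n) {c : ℝ} (hc0 : 0 ≤ c) (hc1 : c < 1) : 0 < lamFee n c := by
  have h := lamFee_strictAntiOn hn ⟨hc0, hc1.le⟩ (right_mem_Icc.2 zero_le_one) hc1
  have h1 : lamFee n 1 = 0 := by simp [lamFee_eq hn]
  rwa [h1] at h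

lemma one_sub_expF {n : ℕ} (hn : 2 ≤ n) {x₀ κ c x : ℝ} (hx₀ : 0 < x₀) (hκ : 0 < κ)
    (hc0 : 0 ≤ c) (hc1 : c < 1) (hx : 0 < x) :
    1 - expF n x₀ κ c x
      = cappedSurvival (1 / ((n : ℝ) - 1)) c (lamFee n c / x₀ ^ κ) (x ^ κ) := by
  have hl := lamFee_pos hn hc0 hc1
  have hiff : x ≤ expXbar n x₀ κ c ↔ c + lamFee n c * (x / x₀) ^ κ ≤ 1 := by
    rw [expXbar, ← div_le_iff₀ hx₀, one_div,
      Real.le_rpow_inv_iff_of_pos (by positivity) (div_nonneg (by linarith) hl.le) hκ,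
      le_div_iff₀ hl]
    constructor <;> intro h <;> linarith
  have harg : lamFee n c / x₀ ^ κ * x ^ κ = lamFee n c * (x / x₀) ^ κ := by
    rw [Real.div_rpow hx.le hx₀.le]; ring
  rw [cappedSurvival, harg, expF, if_neg hx.not_gt]
  split_ifs with h
  · rw [min_eq_right (hiff.1 h)]
  · rw [min_eq_left (le_of_lt (not_le.1 (mt hiff.2 h))), Real.one_rpow]

lemma expMean_eq {n : ℕ} (hn : 2 ≤ n) {x₀ κ c : ℝ} (hx₀ : 0 < x₀) (hκ : 0 < κ)
    (hc0 : 0 ≤ c) (hc1 : c < 1) :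
    expMean n x₀ κ c = ∫ x in Ioi (0 : ℝ),
      cappedSurvival (1 / ((n : ℝ) - 1)) c (lamFee n c / x₀ ^ κ) (x ^ κ) :=
  setIntegral_congr_fun measurableSet_Ioi fun _ hx => one_sub_expF hn hx₀ hκ hc0 hc1 hx

lemma integral_rpow_mul_cappedSurvival_lamFee {n : ℕ} (hn : 2 ≤ n) {x₀ κ c : ℝ} (hx₀ : 0 < x₀)
    (hκ : 0 < κ) (hc0 : 0 ≤ c) (hc1 : c < 1) :
    ∫ x in Ioi (0 : ℝ), x ^ (κ - 1) *
      cappedSurvival (1 / ((n : ℝ) - 1)) c (lamFee n c / x₀ ^ κ) (x ^ κ) = x₀ ^ κ / κ := by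
  have hn' : (2 : ℝ) ≤ n := by exact_mod_cast hn
  have hl := lamFee_pos hn hc0 hc1
  have hx := Real.rpow_pos_of_pos hx₀ κ
  rw [integral_rpow_mul_cappedSurvival hκ, integral_cappedSurvival
    (one_div_pos.2 (by linarith)) (by positivity) hc1, ← lamFee_eq hn, div_div_cancel₀ hl.ne']

/-- For exponential Brownian motion (κ = 1 - 2μ/σ²), the average equilibrium performance
is strictly increasing in the submission fee when `0 < κ < 1` (i.e. `μ > 0`) and strictly
decreasing when `κ > 1` (i.e. `μ < 0`). -/
theorem expF_mean_monotone (n : ℕ) (hn : 2 ≤ n) (x₀ κ : ℝ)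
    (hx₀ : 0 < x₀) (hκ : 0 < κ) (hκ1 : κ ≠ 1)
    (c c' : ℝ) (hc' : 0 ≤ c') (hc'c : c' < c) (hc : c < 1) :
    (κ < 1 → expMean n x₀ κ c' < expMean n x₀ κ c) ∧
    (1 < κ → expMean n x₀ κ c < expMean n x₀ κ c') := by
  have hn' : (2 : ℝ) ≤ n := by exact_mod_cast hn
  have hc0 : 0 ≤ c := hc'.trans hc'c.le
  have hc'1 : c' < 1 := hc'c.trans hc
  have hX : 0 < x₀ ^ κ := Real.rpow_pos_of_pos hx₀ κ
  have hp : 0 < 1 / ((n : ℝ) - 1) := one_div_pos.2 (by linarith)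
  have hl : 0 < lamFee n c / x₀ ^ κ := div_pos (lamFee_pos hn hc0 hc) hX
  have hl' : 0 < lamFee n c' / x₀ ^ κ := div_pos (lamFee_pos hn hc' hc'1) hX
  have hll : lamFee n c / x₀ ^ κ < lamFee n c' / x₀ ^ κ :=
    div_lt_div_of_pos_right
      (lamFee_strictAntiOn hn ⟨hc', hc'1.le⟩ ⟨hc0, hc.le⟩ hc'c) hX
  rw [expMean_eq hn hx₀ hκ hc0 hc, expMean_eq hn hx₀ hκ hc' hc'1]
  have heq := (integral_rpow_mul_cappedSurvival_lamFee hn hx₀ hκ hc0 hc).trans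
    (integral_rpow_mul_cappedSurvival_lamFee hn hx₀ hκ hc' hc'1).symm
  set p := 1 / ((n : ℝ) - 1)
  set l := lamFee n c / x₀ ^ κ
  set l' := lamFee n c' / x₀ ^ κ
  have hy : 0 < (c - c') / (l' - l) := div_pos (by linarith) (by linarith)
  have hY : 0 < (1 - c') / l' := div_pos (by linarith) hl'
  set t := ((c - c') / (l' - l)) ^ κ⁻¹
  have ht : 0 < t := Real.rpow_pos_of_pos hy _
  have hδ : 0 < min t (((1 - c') / l') ^ κ⁻¹) := lt_min ht (Real.rpow_pos_of_pos hY _)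
  have hbelow : ∀ x, 0 < x → x < t → c' + l' * x ^ κ < c + l * x ^ κ := fun x hx hxt => by
    have := (lt_div_iff₀ (by linarith)).1 ((Real.lt_rpow_inv_iff_of_pos hx.le hy.le hκ).1 hxt)
    linarith
  have habove : ∀ x, 0 < x → t ≤ x → c + l * x ^ κ ≤ c' + l' * x ^ κ := fun x hx hxt => by
    have := (div_le_iff₀ (by linarith)).1 ((Real.rpow_inv_le_iff_of_pos hy.le hx.le hκ).1 hxt)
    linarith
  have hnn : ∀ x, 0 < x → 0 ≤ c + l * x ^ κ := fun x hx => by positivity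
  have hnn' : ∀ x, 0 < x → 0 ≤ c' + l' * x ^ κ := fun x hx => by positivity
  have hlt : ∀ x, 0 < x → x < min t (((1 - c') / l') ^ κ⁻¹) →
      cappedSurvival p c l (x ^ κ) < cappedSurvival p c' l' (x ^ κ) := fun x hx hxδ => by
    have := (lt_div_iff₀ hl').1 ((Real.lt_rpow_inv_iff_of_pos hx.le hY.le hκ).1
      (hxδ.trans_le (min_le_right _ _)))
    exact cappedSurvival_lt hp (hnn' x hx) (hbelow x hx (hxδ.trans_le (min_le_left _ _)))
      (by linarith)
  have hk : 0 < t ^ (κ - 1) := Real.rpow_pos_of_pos ht _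
  have hf := integrableOn_cappedSurvival_rpow hp.le hl hc hκ
  have hf' := integrableOn_cappedSurvival_rpow hp.le hl' hc'1 hκ
  have hwf := integrableOn_rpow_mul_cappedSurvival (c := c) hp.le hl hκ
  have hwf' := integrableOn_rpow_mul_cappedSurvival (c := c') hp.le hl' hκ
  constructor
  · intro h
    have hw : κ - 1 < 0 := by linarith
    refine setIntegral_lt_of_single_crossing hk hδ hf hf' hwf hwf' heq
      (fun x hx => ?_) (fun x hx hxδ => ?_)
    · rcases lt_or_ge x t with hxt | hxt
      · exact mul_nonneg_of_nonpos_of_nonpos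
          (sub_nonpos.2 (cappedSurvival_le hp.le (hnn' x hx) (hbelow x hx hxt).le))
          (sub_nonpos.2 (Real.rpow_le_rpow_of_nonpos hx hxt.le hw.le))
      · exact mul_nonneg
          (sub_nonneg.2 (cappedSurvival_le hp.le (hnn x hx) (habove x hx hxt)))
          (sub_nonneg.2 (Real.rpow_le_rpow_of_nonpos ht hxt hw.le))
    · exact mul_pos_of_neg_of_neg (sub_neg.2 (hlt x hx hxδ))
        (sub_neg.2 ((Real.rpow_lt_rpow_iff_of_neg ht hx hw).2
          (hxδ.trans_le (min_le_left _ _))))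
  · intro h
    have hw : 0 < κ - 1 := by linarith
    refine setIntegral_lt_of_single_crossing hk hδ hf' hf hwf' hwf heq.symm
      (fun x hx => ?_) (fun x hx hxδ => ?_)
    · rcases lt_or_ge x t with hxt | hxt
      · exact mul_nonneg
          (sub_nonneg.2 (cappedSurvival_le hp.le (hnn' x hx) (hbelow x hx hxt).le))
          (sub_nonneg.2 (Real.rpow_le_rpow hx.le hxt.le hw.le))
      · exact mul_nonneg_of_nonpos_of_nonpos
          (sub_nonpos.2 (cappedSurvival_le hp.le (hnn x hx) (habove x hx hxt)))
          (sub_nonpos.2 (Real.rpow_le_rpow ht.le hxt hw.le))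
    · exact mul_pos (sub_pos.2 (hlt x hx hxδ))
        (sub_pos.2 (Real.rpow_lt_rpow hx.le (hxδ.trans_le (min_le_left _ _)) hw))
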